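/- arXiv:2007.09556 — 2 statements merged into one kernel-verified Lean document; each statement's English description precedes it below -/
import Mathlib

section
/- For any full-rank lattice $\mathcal{L} \subset \mathbb{R}^n$ with $n \ge 20$, the smoothing parameter satisfies $\eta_{1/2}(\mathcal{L}) \ge \lambda_n(\mathcal{L})/\sqrt{n}$, where $\lambda_n$ is the $n$-th successive minimum. -/
open scoped BigOperators RealInnerProductSpace

noncomputable section

abbrev Euc (n : ℕ) := EuclideanSpace ℝ (Fin n)

def gaussianMass {n : ℕ} (s : ℝ) (A : Set (Euc n)) : ℝ :=
  ∑' x : A, Real.exp (-Real.pi * ‖(x : Euc n)‖ ^ 2 / s ^ 2)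

def dualLattice {n : ℕ} (L : Set (Euc n)) : Set (Euc n) :=
  {x | x ∈ Submodule.span ℝ L ∧ (∀ y ∈ L, ∃ k : ℤ, ⟪x, y⟫ = (k : ℝ))}

def eta {n : ℕ} (ε : ℝ) (L : Set (Euc n)) : ℝ :=
  sInf {s : ℝ | 0 < s ∧ gaussianMass (1 / s) (dualLattice L \ {0}) ≤ ε}

def etaBar {n : ℕ} (ε : ℝ) (L : Submodule ℤ (Euc n)) : ℝ :=
  sInf {t : ℝ | ∃ L' : Submodule ℤ (Euc n), L' ≤ L ∧ L' ≠ ⊥ ∧ t = eta ε (L' : Set (Euc n))}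

def lambdaOne {n : ℕ} (L : Set (Euc n)) : ℝ :=
  sInf {r : ℝ | ∃ x ∈ L, x ≠ 0 ∧ ‖x‖ = r}

def succMin {n : ℕ} (L : Set (Euc n)) (k : ℕ) : ℝ :=
  sInf {r : ℝ | 0 ≤ r ∧ k ≤ Module.finrank ℝ (Submodule.span ℝ {y ∈ L | ‖y‖ ≤ r})}

open MeasureTheory Filter Topology

section PoissonSummation

variable {d : Type*}

/-- The unit cube with corner `m`. -/
def unitCube (m : d → ℤ) : Set (d → ℝ) := {x | ∀ i, x i ∈ Set.Ioc (m i : ℝ) (m i + 1)}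

lemma mem_unitCube_iff {m : d → ℤ} {x : d → ℝ} : x ∈ unitCube m ↔ ∀ i, ⌈x i⌉ = m i + 1 := by
  refine forall_congr' fun i ↦ ?_
  rw [Int.ceil_eq_iff]
  simp

lemma pairwise_disjoint_unitCube : Pairwise (Function.onFun Disjoint (unitCube (d := d))) := by
  intro m k hmk
  refine Set.disjoint_left.2 fun x hm hk ↦ hmk (funext fun i ↦ ?_)
  have h₁ := mem_unitCube_iff.1 hm i
  have h₂ := mem_unitCube_iff.1 hk i
  lia

lemma iUnion_unitCube : ⋃ m, unitCube (d := d) m = Set.univ :=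
  Set.eq_univ_of_forall fun x ↦ Set.mem_iUnion.2
    ⟨fun i ↦ ⌈x i⌉ - 1, mem_unitCube_iff.2 fun i ↦ by ring⟩

variable [Fintype d]

lemma measurableSet_unitCube (m : d → ℤ) : MeasurableSet (unitCube m) :=
  MeasurableSet.univ_pi' fun _ ↦ measurableSet_Ioc

lemma setIntegral_unitCube {E : Type*} [NormedAddCommGroup E] [NormedSpace ℝ E]
    (g : (d → ℝ) → E) (m : d → ℤ) :
    ∫ x in unitCube m, g x = ∫ x in unitCube 0, g (x + fun i ↦ (m i : ℝ)) := by
  have h := (measurePreserving_add_right (volume : Measure (d → ℝ))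
    (fun i ↦ (m i : ℝ))).setIntegral_preimage_emb (measurableEmbedding_addRight _) g (unitCube m)
  rw [← h]
  congr 2
  ext x
  simp [unitCube, add_comm (x _)]

lemma MeasureTheory.Integrable.hasSum_integral_unitCube {E : Type*} [NormedAddCommGroup E]
    [NormedSpace ℝ E] {g : (d → ℝ) → E} (hg : Integrable g) :
    HasSum (fun m : d → ℤ ↦ ∫ x in unitCube 0, g (x + fun i ↦ (m i : ℝ))) (∫ x, g x) := by
  simp_rw [← setIntegral_unitCube]
  simpa [iUnion_unitCube] using hasSum_integral_iUnion (f := g) (μ := volume)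
    measurableSet_unitCube pairwise_disjoint_unitCube hg.integrableOn

/-- The integral of an integrable function is the integral over the unit cube of its
periodization. -/
lemma MeasureTheory.Integrable.integral_unitCube_tsum {g : (d → ℝ) → ℂ} (hg : Integrable g) :
    ∫ x in unitCube 0, ∑' m : d → ℤ, g (x + fun i ↦ (m i : ℝ)) = ∫ x, g x := by
  refine (hasSum_integral_of_summable_integral_norm (fun m ↦ ?_) ?_).unique
    hg.hasSum_integral_unitCube
  · exact (hg.comp_add_right _).integrableOn
  · exact hg.norm.hasSum_integral_unitCube.summable

lemma mFourier_coe (k : d → ℤ) (x : d → ℝ) :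
    UnitAddTorus.mFourier k (fun i ↦ (x i : UnitAddCircle)) =
      Complex.exp (2 * Real.pi * Complex.I * ((∑ i, k i * x i : ℝ) : ℂ)) := by
  simp only [UnitAddTorus.mFourier, ContinuousMap.coe_mk, fourier_coe_apply, ← Complex.exp_sum]
  congr 1
  push_cast
  rw [Finset.mul_sum]
  refine Finset.sum_congr rfl fun i _ ↦ ?_
  simp; ring

/-- **Poisson summation formula** for the integer lattice. -/
theorem hasSum_poisson_pi {f : (d → ℝ) → ℂ} (hc : Continuous f) (hi : Integrable f)
    (hf : ∀ R : ℝ, ∃ u : (d → ℤ) → ℝ, Summable u ∧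
      ∀ x : d → ℝ, ‖x‖ ≤ R → ∀ k : d → ℤ, ‖f (x + fun i ↦ (k i : ℝ))‖ ≤ u k)
    {c : (d → ℤ) → ℂ} (hcs : Summable c)
    (hcf : ∀ k : d → ℤ,
      ∫ x, Complex.exp (-(2 * Real.pi * Complex.I * ((∑ i, k i * x i : ℝ) : ℂ))) * f x = c k)
    (x : d → ℝ) :
    HasSum (fun k : d → ℤ ↦
        c k * Complex.exp (2 * Real.pi * Complex.I * ((∑ i, k i * x i : ℝ) : ℂ)))
      (∑' k : d → ℤ, f (x + fun i ↦ (k i : ℝ))) := by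
  set P : (d → ℝ) → ℂ := fun x ↦ ∑' k : d → ℤ, f (x + fun i ↦ (k i : ℝ)) with hP
  have hPc : Continuous P := by
    refine continuous_iff_continuousAt.2 fun x ↦ ?_
    obtain ⟨u, hu, hfu⟩ := hf (‖x‖ + 1)
    have : ContinuousOn P (Metric.closedBall 0 (‖x‖ + 1)) :=
      continuousOn_tsum (fun k ↦ (hc.comp (continuous_id.add continuous_const)).continuousOn) hu
        fun k y hy ↦ hfu y (by simpa using hy) k
    refine this.continuousAt (Metric.closedBall_mem_nhds_of_mem ?_)
    simp
  have hPper : ∀ (x : d → ℝ) (m : d → ℤ), P (x + fun i ↦ (m i : ℝ)) = P x := by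
    intro x m
    rw [hP]
    simp only
    rw [← (Equiv.addLeft m).tsum_eq (fun k : d → ℤ ↦ f (x + fun i ↦ (k i : ℝ)))]
    refine tsum_congr fun k ↦ ?_
    congr 1
    ext i
    simp [add_assoc]
  let q : (d → ℝ) → UnitAddTorus d := Pi.map fun _ ↦ ((↑) : ℝ → UnitAddCircle)
  have hq : IsOpenQuotientMap q :=
    IsOpenQuotientMap.piMap fun _ ↦ QuotientAddGroup.isOpenQuotientMap_mk
  have hPq : ∀ x y, q x = q y → P x = P y := by
    intro x y hxy
    have h : ∀ i, ∃ m : ℤ, x i = y i + m := by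
      intro i
      have := congrFun hxy i
      simp only [q, Pi.map_apply] at this
      rw [← sub_eq_zero, ← AddCircle.coe_sub, AddCircle.coe_eq_zero_iff] at this
      obtain ⟨m, hm⟩ := this
      refine ⟨m, ?_⟩
      rw [zsmul_one] at hm
      linarith
    choose m hm using h
    rw [← hPper y m]
    congr 1
    ext i
    exact hm i
  have hq' : IsQuotientMap (⟨q, hq.continuous⟩ : C(d → ℝ, UnitAddTorus d)) := hq.isQuotientMap
  let F : C(UnitAddTorus d, ℂ) := hq'.lift ⟨P, hPc⟩ fun x y ↦ hPq x y
  have hF : ∀ x : d → ℝ, F (fun i ↦ (x i : UnitAddCircle)) = P x := by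
    intro x
    exact DFunLike.congr_fun (hq'.lift_comp ⟨P, hPc⟩ fun x y ↦ hPq x y) x
  have hcoef : UnitAddTorus.mFourierCoeff F = c := by
    ext k
    rw [UnitAddTorus.mFourierCoeff_eq_integral _ _ 0, ← hcf k]
    have he : ∀ x : d → ℝ, UnitAddTorus.mFourier (-k) (fun i ↦ (x i : UnitAddCircle)) =
        Complex.exp (-(2 * Real.pi * Complex.I * ((∑ i, k i * x i : ℝ) : ℂ))) := by
      intro x
      rw [mFourier_coe]
      congr 1
      push_cast
      simp
    have hg : Integrable fun x : d → ℝ ↦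
        Complex.exp (-(2 * Real.pi * Complex.I * ((∑ i, k i * x i : ℝ) : ℂ))) * f x := by
      refine hi.bdd_mul (c := 1) (Continuous.aestronglyMeasurable (by fun_prop))
        (ae_of_all _ fun x ↦ ?_)
      rw [← he x]
      exact (ContinuousMap.norm_coe_le_norm _ _).trans_eq UnitAddTorus.mFourier_norm
    rw [← hg.integral_unitCube_tsum]
    have hs : {x : d → ℝ | ∀ i, x i ∈ Set.Ioc ((0 : d → ℝ) i) ((0 : d → ℝ) i + 1)} =
        unitCube 0 := by
      simp [unitCube]
    rw [hs]
    congr 1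
    ext x
    rw [hF, smul_eq_mul, hP, ← tsum_mul_left]
    refine tsum_congr fun m ↦ ?_
    rw [← he (x + _)]
    congr 2
    ext i
    simp
  have := UnitAddTorus.hasSum_mFourier_series_apply_of_summable (f := F) (hcoef ▸ hcs)
    (fun i ↦ (x i : UnitAddCircle))
  simpa only [hcoef, hF, smul_eq_mul, mFourier_coe] using this

end PoissonSummation

section LatticeGaussian

lemma summable_prod_apply {f : ℤ → ℝ} (hf : Summable f) (h0 : ∀ k, 0 ≤ f k) :
    ∀ n : ℕ, Summable fun k : Fin n → ℤ ↦ ∏ i, f (k i)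
  | 0 => Summable.of_finite
  | n + 1 => by
    rw [← (Fin.consEquiv fun _ : Fin (n + 1) ↦ ℤ).summable_iff]
    have := hf.mul_of_nonneg (summable_prod_apply hf h0 n) h0
      fun k ↦ Finset.prod_nonneg fun i _ ↦ h0 _
    refine this.congr fun p ↦ ?_
    simp [Fin.prod_univ_succ, Fin.consEquiv]

lemma summable_exp_neg_mul_int_sq {a : ℝ} (ha : 0 < a) :
    Summable fun k : ℤ ↦ Real.exp (-a * (k : ℝ) ^ 2) := by
  have h : Summable fun k : ℕ ↦ Real.exp (-a * (k : ℝ) ^ 2) := by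
    refine Summable.of_nonneg_of_le (fun _ ↦ (Real.exp_pos _).le) (fun k ↦ ?_)
      (Real.summable_exp_nat_mul_iff.2 (neg_lt_zero.2 ha))
    refine Real.exp_le_exp.2 ?_
    have : (k : ℝ) ≤ (k : ℝ) ^ 2 := by exact_mod_cast Nat.le_self_pow two_ne_zero k
    nlinarith
  exact Summable.of_nat_of_neg (by simpa using h) (by simpa using h)

variable {n : ℕ} {E : Type*} [NormedAddCommGroup E] [NormedSpace ℝ E]

/-- The Gaussian of a lattice translate is summable, uniformly on bounded sets of translations. -/
lemma exists_summable_bound_gaussian (V : (Fin n → ℝ) ≃L[ℝ] E) {c : ℝ} (hc : 0 < c) (R : ℝ) :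
    ∃ u : (Fin n → ℤ) → ℝ, Summable u ∧ ∀ x : Fin n → ℝ, ‖x‖ ≤ R → ∀ k : Fin n → ℤ,
      Real.exp (-c * ‖V (x + fun i ↦ (k i : ℝ))‖ ^ 2) ≤ u k := by
  obtain ⟨K, hK, hV⟩ : ∃ K : ℝ, 0 < K ∧ ∀ x, ‖x‖ ≤ K * ‖V x‖ := by
    refine ⟨‖(V.symm : E →L[ℝ] (Fin n → ℝ))‖ + 1, by positivity, fun x ↦ ?_⟩
    have := (V.symm : E →L[ℝ] (Fin n → ℝ)).le_opNorm (V x)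
    simp only [ContinuousLinearEquiv.coe_coe, ContinuousLinearEquiv.symm_apply_apply] at this
    nlinarith [norm_nonneg (V x)]
  set a : ℝ := c / K ^ 2 with ha
  have ha0 : 0 < a := by positivity
  set a' : ℝ := a / (2 * (n + 1)) with ha'
  have ha'0 : 0 < a' := by positivity
  refine ⟨fun k ↦ Real.exp (a * R ^ 2) * ∏ i, Real.exp (-a' * (k i : ℝ) ^ 2),
    (summable_prod_apply (summable_exp_neg_mul_int_sq ha'0) (fun _ ↦ (Real.exp_pos _).le)
      n).mul_left _, fun x hx k ↦ ?_⟩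
  dsimp only
  rw [← Real.exp_sum, ← Real.exp_add, Real.exp_le_exp, ← Finset.mul_sum]
  set y : Fin n → ℝ := fun i ↦ (k i : ℝ) with hy
  have h₁ : ∑ i, (k i : ℝ) ^ 2 ≤ (n + 1) * ‖y‖ ^ 2 := by
    calc ∑ i, (k i : ℝ) ^ 2 ≤ ∑ _i : Fin n, ‖y‖ ^ 2 := by
          refine Finset.sum_le_sum fun i _ ↦ ?_
          rw [← sq_abs]
          gcongr
          exact norm_le_pi_norm y i
      _ = n * ‖y‖ ^ 2 := by simp
      _ ≤ _ := by gcongr; linarith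
  have h₂ : ‖y‖ ≤ ‖x + y‖ + R := by
    have := norm_sub_le (x + y) x
    rw [add_sub_cancel_left] at this
    linarith
  have h₃ : ‖y‖ ^ 2 ≤ 2 * ‖x + y‖ ^ 2 + 2 * R ^ 2 := by
    nlinarith [norm_nonneg y, sq_nonneg (‖x + y‖ - R), pow_le_pow_left₀ (norm_nonneg y) h₂ 2]
  have h₄ : a * ‖x + y‖ ^ 2 ≤ c * ‖V (x + y)‖ ^ 2 := by
    rw [ha, div_mul_eq_mul_div, div_le_iff₀ (by positivity), mul_assoc]
    gcongr
    rw [← mul_pow, mul_comm]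
    exact pow_le_pow_left₀ (norm_nonneg _) (hV _) 2
  have h₅ : a' * ∑ i, (k i : ℝ) ^ 2 ≤ a / 2 * ‖y‖ ^ 2 := by
    calc _ ≤ a' * ((n + 1) * ‖y‖ ^ 2) := by gcongr
      _ = _ := by rw [ha']; field_simp
  nlinarith

lemma summable_gaussian (V : (Fin n → ℝ) ≃L[ℝ] E) {c : ℝ} (hc : 0 < c) (x : Fin n → ℝ) :
    Summable fun k : Fin n → ℤ ↦ Real.exp (-c * ‖V (x + fun i ↦ (k i : ℝ))‖ ^ 2) := by
  obtain ⟨u, hu, h⟩ := exists_summable_bound_gaussian V hc ‖x‖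
  exact hu.of_nonneg_of_le (fun _ ↦ (Real.exp_pos _).le) (h x le_rfl)

/-- Integrals over `E` and over coordinate space agree up to a positive factor. -/
lemma exists_integral_comp_eq_mul [MeasurableSpace E] [BorelSpace E] (μ : Measure E)
    [μ.IsAddHaarMeasure] (T : (Fin n → ℝ) ≃L[ℝ] E) :
    ∃ C : ℝ, 0 < C ∧ (∀ f : E → ℂ, ∫ x, f (T x) = C * ∫ y, f y ∂μ) ∧
      ∀ f : E → ℂ, Integrable f μ → Integrable fun x ↦ f (T x) := by
  have hT : MeasurableEmbedding T := T.toHomeomorph.measurableEmbedding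
  have : (Measure.map T volume).IsAddHaarMeasure := T.isAddHaarMeasure_map _
  have : FiniteDimensional ℝ E := T.toLinearEquiv.finiteDimensional
  have hμ := Measure.isAddLeftInvariant_eq_smul (Measure.map T volume) μ
  set C := Measure.addHaarScalarFactor (Measure.map T volume) μ with hC
  refine ⟨C, Measure.addHaarScalarFactor_pos_of_isAddHaarMeasure _ _, fun f ↦ ?_, fun f hf ↦ ?_⟩
  · rw [← hT.integral_map, hμ, integral_smul_nnreal_measure]
    rfl
  · have := hf.smul_measure_nnreal (c := C)
    rw [← hμ] at this
    exact hT.integrable_map_iff.1 this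

/-- **Poisson summation** for Gaussians on a lattice with coordinate map `T` and dual coordinate
map `W`. -/
theorem hasSum_poisson_gaussian (T W : (Fin n → ℝ) ≃L[ℝ] EuclideanSpace ℝ (Fin n))
    (hW : ∀ k x, ⟪W k, T x⟫ = ∑ i, k i * x i) :
    ∃ C : ℝ, 0 < C ∧ ∀ s : ℝ, 0 < s → ∀ x : Fin n → ℝ,
      HasSum (fun k : Fin n → ℤ ↦
        ((C * s ^ n * Real.exp (-(Real.pi * s ^ 2) * ‖W fun i ↦ (k i : ℝ)‖ ^ 2) : ℝ) : ℂ) *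
          Complex.exp (2 * Real.pi * Complex.I * ((∑ i, k i * x i : ℝ) : ℂ)))
        ((∑' k : Fin n → ℤ,
          Real.exp (-(Real.pi / s ^ 2) * ‖T (x + fun i ↦ (k i : ℝ))‖ ^ 2) : ℝ) : ℂ) := by
  obtain ⟨C, hC, hintegral, hinteg⟩ := exists_integral_comp_eq_mul volume T
  refine ⟨C, hC, fun s hs x ↦ ?_⟩
  have hb : 0 < ((Real.pi / s ^ 2 : ℝ) : ℂ).re := by
    rw [Complex.ofReal_re]; positivity
  have hpi := Real.pi_ne_zero
  have hcs := (summable_gaussian W (c := Real.pi * s ^ 2) (by positivity) 0).mul_left (C * s ^ n)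
  simp only [zero_add] at hcs
  rw [Complex.ofReal_tsum]
  refine hasSum_poisson_pi
    (f := fun x ↦ ((Real.exp (-(Real.pi / s ^ 2) * ‖T x‖ ^ 2) : ℝ) : ℂ)) (by fun_prop) ?_ ?_
    (c := fun k ↦
      ((C * s ^ n * Real.exp (-(Real.pi * s ^ 2) * ‖W fun i ↦ (k i : ℝ)‖ ^ 2) : ℝ) : ℂ))
    (by exact_mod_cast hcs) (fun k ↦ ?_) x
  · refine hinteg (fun y ↦ ((Real.exp (-(Real.pi / s ^ 2) * ‖y‖ ^ 2) : ℝ) : ℂ)) ?_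
    have := GaussianFourier.integrable_cexp_neg_mul_sq_norm_add hb 0
      (0 : EuclideanSpace ℝ (Fin n))
    simpa using this
  · intro R
    obtain ⟨u, hu, h⟩ := exists_summable_bound_gaussian T (c := Real.pi / s ^ 2) (by positivity) R
    refine ⟨u, hu, fun x hx k ↦ ?_⟩
    rw [Complex.norm_real, Real.norm_of_nonneg (Real.exp_pos _).le]
    exact h x hx k
  · set w := W fun i ↦ (k i : ℝ) with hw
    have h := hintegral fun y ↦ Complex.exp (-((Real.pi / s ^ 2 : ℝ) : ℂ) * ‖y‖ ^ 2 +
      (-(2 * Real.pi * Complex.I)) * ⟪w, y⟫)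
    rw [GaussianFourier.integral_cexp_neg_mul_sq_norm_add hb] at h
    have hpow : (Real.pi / ((Real.pi / s ^ 2 : ℝ) : ℂ)) ^
        (Module.finrank ℝ (EuclideanSpace ℝ (Fin n)) / 2 : ℂ) = ((s ^ n : ℝ) : ℂ) := by
      have h₁ : (Real.pi / ((Real.pi / s ^ 2 : ℝ) : ℂ)) = ((s ^ 2 : ℝ) : ℂ) := by
        have : (s : ℂ) ≠ 0 := by exact_mod_cast hs.ne'
        have : (Real.pi : ℂ) ≠ 0 := by exact_mod_cast hpi
        push_cast
        field_simp
      have h₂ : (Module.finrank ℝ (EuclideanSpace ℝ (Fin n)) / 2 : ℂ) = ((n / 2 : ℝ) : ℂ) := by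
        simp
      rw [h₁, h₂, ← Complex.ofReal_cpow (by positivity), ← Real.rpow_natCast s 2,
        ← Real.rpow_mul hs.le, ← Real.rpow_natCast s n]
      congr 2
      push_cast
      ring
    rw [hpow] at h
    convert h using 1
    · congr 1
      ext y
      rw [hw, hW, Complex.ofReal_exp, ← Complex.exp_add]
      congr 1
      push_cast
      ring
    · push_cast
      rw [mul_assoc]
      congr 3
      have : (s : ℂ) ≠ 0 := by exact_mod_cast hs.ne'
      have : (Real.pi : ℂ) ≠ 0 := by exact_mod_cast hpi
      field_simp
      rw [Complex.I_sq]
      ring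

/-- The Gaussian mass of a lattice translate differs from its mean value by at most the mass of the
nonzero dual vectors. -/
theorem exists_abs_gaussian_sub_le (T W : (Fin n → ℝ) ≃L[ℝ] EuclideanSpace ℝ (Fin n))
    (hW : ∀ k x, ⟪W k, T x⟫ = ∑ i, k i * x i) :
    ∃ C : ℝ, 0 < C ∧ ∀ s : ℝ, 0 < s → ∀ x : Fin n → ℝ,
      |∑' k : Fin n → ℤ, Real.exp (-(Real.pi / s ^ 2) * ‖T (x + fun i ↦ (k i : ℝ))‖ ^ 2) -
        C * s ^ n| ≤ C * s ^ n * ∑' k : ({0}ᶜ : Set (Fin n → ℤ)),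
          Real.exp (-(Real.pi * s ^ 2) * ‖W fun i ↦ (k.1 i : ℝ)‖ ^ 2) := by
  obtain ⟨C, hC, h⟩ := hasSum_poisson_gaussian T W hW
  refine ⟨C, hC, fun s hs x ↦ ?_⟩
  have hsum := (summable_gaussian W (c := Real.pi * s ^ 2) (by positivity) 0).mul_left (C * s ^ n)
  simp only [zero_add] at hsum
  have hx := h s hs x
  set f : (Fin n → ℤ) → ℂ := fun k ↦
        ((C * s ^ n * Real.exp (-(Real.pi * s ^ 2) * ‖W fun i ↦ (k i : ℝ)‖ ^ 2) : ℝ) : ℂ) *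
          Complex.exp (2 * Real.pi * Complex.I * ((∑ i, k i * x i : ℝ) : ℂ)) with hf
  have hnorm : ∀ k, ‖f k‖ =
      C * s ^ n * Real.exp (-(Real.pi * s ^ 2) * ‖W fun i ↦ (k i : ℝ)‖ ^ 2) := by
    intro k
    have he : 2 * Real.pi * Complex.I * ((∑ i, k i * x i : ℝ) : ℂ) =
        ((2 * Real.pi * ∑ i, k i * x i : ℝ) : ℂ) * Complex.I := by
      push_cast
      ring
    rw [hf]
    dsimp only
    rw [he, norm_mul, Complex.norm_real, Real.norm_of_nonneg (by positivity),
      Complex.norm_exp_ofReal_mul_I, mul_one]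
  have hf0 : f 0 = ((C * s ^ n : ℝ) : ℂ) := by
    have : W (fun _ ↦ 0) = 0 := map_zero W
    simp [hf, this]
  have hsplit := hx.summable.tsum_subtype_add_tsum_subtype_compl {0}
  rw [hx.tsum_eq, tsum_singleton, hf0] at hsplit
  rw [← Real.norm_eq_abs, ← Complex.norm_real, Complex.ofReal_sub, ← hsplit, add_sub_cancel_left,
    ← tsum_mul_left]
  refine (norm_tsum_le_tsum_norm ?_).trans_eq (tsum_congr fun k ↦ hnorm k)
  simp_rw [hnorm]
  exact hsum.subtype _

/-- The numerical form of the Gaussian tail bound at half of `√n` standard deviations. -/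
lemma three_mul_tail_pow_lt_one (hn : 20 ≤ n) :
    3 * (√(Real.pi / 2) ^ n * Real.exp (-((Real.pi - 2) * n / 4))) < 1 := by
  set q : ℝ := Real.pi / 2 * Real.exp (-(Real.pi / 2 - 1)) with hq
  have hq0 : 0 ≤ q := by positivity
  have hq1 : q ≤ 0.8955 := by
    have h₁ : (1.767 : ℝ) ≤ Real.exp 0.57 := by
      refine le_trans ?_ (Real.sum_le_exp_of_nonneg (by norm_num) 5)
      norm_num [Finset.sum_range_succ, Nat.factorial]
    have h₂ : Real.exp 0.57 ≤ Real.exp (Real.pi / 2 - 1) :=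
      Real.exp_le_exp.2 (by linarith [Real.pi_gt_d2])
    rw [hq, Real.exp_neg, ← div_eq_mul_inv, div_le_iff₀ (Real.exp_pos _)]
    linarith [Real.pi_lt_d4]
  have hsq : √q ^ 2 = q := Real.sq_sqrt hq0
  have hexp : √q ^ n = √(Real.pi / 2) ^ n * Real.exp (-((Real.pi - 2) * n / 4)) := by
    have : √q = √(Real.pi / 2) * Real.exp (-((Real.pi - 2) / 4)) := by
      rw [hq, Real.sqrt_mul (by positivity), ← Real.exp_half]
      ring_nf
    rw [this, mul_pow, ← Real.exp_nat_mul]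
    ring_nf
  rw [← hexp]
  have h₁ : √q ^ n ≤ √q ^ 20 :=
    pow_le_pow_of_le_one (Real.sqrt_nonneg _) (Real.sqrt_le_one.2 (by linarith)) hn
  have h₂ : √q ^ 20 = q ^ 10 := by rw [pow_mul (√q) 2 10, hsq]
  have h₃ : q ^ 10 ≤ 0.8955 ^ 10 := pow_le_pow_left₀ hq0 hq1 10
  norm_num at h₃ ⊢
  linarith

/-- If the nonzero dual vectors have Gaussian mass at most `1/2`, then the covering radius of the
lattice is at most `s√n/2`. -/
theorem exists_norm_le_of_dual_mass_le (hn : 20 ≤ n)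
    (T W : (Fin n → ℝ) ≃L[ℝ] EuclideanSpace ℝ (Fin n))
    (hW : ∀ k x, ⟪W k, T x⟫ = ∑ i, k i * x i) {s : ℝ} (hs : 0 < s)
    (hmass : ∑' k : ({0}ᶜ : Set (Fin n → ℤ)),
      Real.exp (-(Real.pi * s ^ 2) * ‖W fun i ↦ (k.1 i : ℝ)‖ ^ 2) ≤ 1 / 2) (x : Fin n → ℝ) :
    ∃ k : Fin n → ℤ, ‖T (x + fun i ↦ (k i : ℝ))‖ ≤ s * √n / 2 := by
  by_contra! hfar
  obtain ⟨C, hC, h⟩ := exists_abs_gaussian_sub_le T W hW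
  have hpi := Real.pi_pos
  set t : ℝ := s * √(Real.pi / 2) with ht
  have ht2 : t ^ 2 = s ^ 2 * (Real.pi / 2) := by
    rw [ht, mul_pow, Real.sq_sqrt (by positivity)]
  have ht0 : 0 < t := by positivity
  have hst : s ^ 2 ≤ t ^ 2 := by
    rw [ht2]
    nlinarith [Real.pi_gt_three, pow_pos hs 2]
  have hdual : ∀ r : ℝ, 0 < r → Summable fun k : ({0}ᶜ : Set (Fin n → ℤ)) ↦
      Real.exp (-(Real.pi * r ^ 2) * ‖W fun i ↦ (k.1 i : ℝ)‖ ^ 2) := by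
    intro r hr
    have := summable_gaussian W (c := Real.pi * r ^ 2) (by positivity) 0
    simp only [zero_add] at this
    exact this.subtype _
  have hmass' : ∑' k : ({0}ᶜ : Set (Fin n → ℤ)),
      Real.exp (-(Real.pi * t ^ 2) * ‖W fun i ↦ (k.1 i : ℝ)‖ ^ 2) ≤ 1 / 2 := by
    refine ((hdual t ht0).tsum_le_tsum (fun k ↦ ?_) (hdual s hs)).trans hmass
    gcongr
  have hlow := (abs_le.1 (h s hs x)).1
  have hup := (abs_le.1 (h t ht0 x)).2
  have hcompare : ∑' k : Fin n → ℤ,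
      Real.exp (-(Real.pi / s ^ 2) * ‖T (x + fun i ↦ (k i : ℝ))‖ ^ 2) ≤
      Real.exp (-((Real.pi - 2) * n / 4)) * ∑' k : Fin n → ℤ,
        Real.exp (-(Real.pi / t ^ 2) * ‖T (x + fun i ↦ (k i : ℝ))‖ ^ 2) := by
    rw [← tsum_mul_left]
    refine (summable_gaussian T (by positivity) x).tsum_le_tsum (fun k ↦ ?_)
      ((summable_gaussian T (by positivity) x).mul_left _)
    rw [← Real.exp_add, Real.exp_le_exp]
    have hk : s ^ 2 * n / 4 ≤ ‖T (x + fun i ↦ (k i : ℝ))‖ ^ 2 := by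
      have := pow_le_pow_left₀ (by positivity) (hfar k).le 2
      rw [div_pow, mul_pow, Real.sq_sqrt (by positivity)] at this
      linarith
    have h₁ : Real.pi / t ^ 2 = 2 / s ^ 2 := by
      rw [ht2]; field_simp
    have h₂ : (Real.pi - 2) * n / 4 ≤
        (Real.pi - 2) / s ^ 2 * ‖T (x + fun i ↦ (k i : ℝ))‖ ^ 2 := by
      calc (Real.pi - 2) * n / 4 = (Real.pi - 2) / s ^ 2 * (s ^ 2 * n / 4) := by field_simp
        _ ≤ _ := by
          gcongr
          exact div_nonneg (by linarith [Real.pi_gt_three]) (by positivity)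
    rw [h₁]
    have h₃ : (Real.pi - 2) / s ^ 2 = Real.pi / s ^ 2 - 2 / s ^ 2 := sub_div _ _ _
    rw [h₃] at h₂
    linarith
  have htn : t ^ n = s ^ n * √(Real.pi / 2) ^ n := by rw [ht, mul_pow]
  have hnum := three_mul_tail_pow_lt_one hn
  have hCs : 0 < C * s ^ n := by positivity
  have hCt : 0 < C * t ^ n := by positivity
  have h₁ : C * s ^ n * (1 / 2) ≤ ∑' k : Fin n → ℤ,
      Real.exp (-(Real.pi / s ^ 2) * ‖T (x + fun i ↦ (k i : ℝ))‖ ^ 2) := by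
    nlinarith
  have h₂ : ∑' k : Fin n → ℤ,
      Real.exp (-(Real.pi / t ^ 2) * ‖T (x + fun i ↦ (k i : ℝ))‖ ^ 2) ≤ C * t ^ n * (3 / 2) := by
    nlinarith
  have h₃ := h₁.trans (hcompare.trans (mul_le_mul_of_nonneg_left h₂ (Real.exp_pos _).le))
  rw [htn] at h₃
  nlinarith

end LatticeGaussian

section SmoothingParameter

variable {n : ℕ}

/-- A basis and its dual basis, as coordinate maps. -/
lemma exists_coordinate_maps {b : Fin n → Euc n} (hb : LinearIndependent ℝ b) :
    ∃ T W : (Fin n → ℝ) ≃L[ℝ] Euc n, (∀ x, T x = ∑ i, x i • b i) ∧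
      (∀ k x, ⟪W k, T x⟫ = ∑ i, k i * x i) ∧ ∀ k i, ⟪W k, b i⟫ = k i := by
  classical
  let B := basisOfLinearIndependentOfCardEqFinrank' b hb (by simp)
  have hB : ∀ i, B i = b i := fun i ↦ by simp [B]
  let T : (Fin n → ℝ) ≃L[ℝ] Euc n := B.equivFun.symm.toContinuousLinearEquiv
  have hT : ∀ x, T x = ∑ i, x i • b i := fun x ↦ by
    simp [T, B.equivFun_symm_apply, hB]
  let A : Euc n →ₗ[ℝ] (Fin n → ℝ) := LinearMap.pi fun i ↦ (innerₗ (Euc n)).flip (b i)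
  have hA : ∀ w i, A w i = ⟪w, b i⟫ := fun w i ↦ rfl
  have hAinj : Function.Injective A := by
    refine (injective_iff_map_eq_zero A).2 fun w hw ↦ (ext_inner_right ℝ fun v ↦ ?_)
    rw [← B.sum_repr v, inner_zero_left, inner_sum]
    refine Finset.sum_eq_zero fun i _ ↦ ?_
    rw [inner_smul_right, hB, ← hA, hw, Pi.zero_apply, mul_zero]
  let W : (Fin n → ℝ) ≃L[ℝ] Euc n :=
    (A.linearEquivOfInjective hAinj (by simp)).symm.toContinuousLinearEquiv
  have hWb : ∀ k i, ⟪W k, b i⟫ = k i := fun k i ↦ by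
    rw [← hA]
    exact congrFun ((A.linearEquivOfInjective hAinj (by simp)).apply_symm_apply k) i
  refine ⟨T, W, hT, fun k x ↦ ?_, hWb⟩
  rw [hT, inner_sum]
  refine Finset.sum_congr rfl fun i _ ↦ ?_
  rw [inner_smul_right, hWb, mul_comm]

lemma mem_span_int_range_iff {b : Fin n → Euc n} {y : Euc n} :
    y ∈ Submodule.span ℤ (Set.range b) ↔ ∃ m : Fin n → ℤ, y = ∑ i, (m i : ℝ) • b i := by
  rw [Submodule.mem_span_range_iff_exists_fun]
  simp only [Int.cast_smul_eq_zsmul, eq_comm]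

/-- The dual lattice is the integer span of the dual basis. -/
lemma dualLattice_span_eq_range {b : Fin n → Euc n} (hb : LinearIndependent ℝ b)
    {W : (Fin n → ℝ) ≃L[ℝ] Euc n} (hW : ∀ k i, ⟪W k, b i⟫ = k i) :
    dualLattice (Submodule.span ℤ (Set.range b) : Set (Euc n)) =
      Set.range fun k : Fin n → ℤ ↦ W fun i ↦ (k i : ℝ) := by
  have hspan : Submodule.span ℝ (Submodule.span ℤ (Set.range b) : Set (Euc n)) = ⊤ := by
    rw [Submodule.span_span_of_tower]
    exact hb.span_eq_top_of_card_eq_finrank' (by simp)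
  ext w
  simp only [dualLattice, hspan, Submodule.mem_top, true_and, Set.mem_ofPred_eq, SetLike.mem_coe,
    Set.mem_range]
  constructor
  · intro h
    choose k hk using fun i ↦ h (b i) (Submodule.subset_span ⟨i, rfl⟩)
    refine ⟨k, W.symm.injective ?_⟩
    ext i
    rw [W.symm_apply_apply, ← hk, ← hW (W.symm w), W.apply_symm_apply]
  · rintro ⟨k, rfl⟩ y hy
    obtain ⟨m, rfl⟩ := mem_span_int_range_iff.1 hy
    refine ⟨∑ i, m i * k i, ?_⟩
    simp [inner_sum, inner_smul_right, hW]

lemma gaussianMass_dualLattice_eq {b : Fin n → Euc n} (hb : LinearIndependent ℝ b)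
    {W : (Fin n → ℝ) ≃L[ℝ] Euc n} (hW : ∀ k i, ⟪W k, b i⟫ = k i) (s : ℝ) :
    gaussianMass (1 / s) (dualLattice (Submodule.span ℤ (Set.range b) : Set (Euc n)) \ {0}) =
      ∑' k : ({0}ᶜ : Set (Fin n → ℤ)),
        Real.exp (-(Real.pi * s ^ 2) * ‖W fun i ↦ (k.1 i : ℝ)‖ ^ 2) := by
  set e : (Fin n → ℤ) → Euc n := fun k ↦ W fun i ↦ (k i : ℝ) with he
  have hinj : Function.Injective e := by
    intro k l hkl
    ext i
    exact_mod_cast congrFun (W.injective hkl) i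
  have he0 : e 0 = 0 := by
    have : W (fun _ ↦ 0) = 0 := map_zero W
    simpa [he] using this
  have himage : dualLattice (Submodule.span ℤ (Set.range b) : Set (Euc n)) \ {0} = e '' {0}ᶜ := by
    rw [dualLattice_span_eq_range hb hW, ← Set.image_univ, ← he0, ← Set.image_singleton,
      ← Set.image_sdiff hinj, ← Set.compl_eq_univ_sdiff]
  rw [gaussianMass, himage, tsum_image (fun x : Euc n ↦
    Real.exp (-Real.pi * ‖x‖ ^ 2 / (1 / s) ^ 2)) hinj.injOn]
  refine tsum_congr fun k ↦ ?_
  rw [one_div, inv_pow, div_inv_eq_mul]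
  congr 1
  ring

lemma exists_dual_mass_le (W : (Fin n → ℝ) ≃L[ℝ] Euc n) {ε : ℝ} (hε : 0 < ε) :
    ∃ s : ℝ, 0 < s ∧ ∑' k : ({0}ᶜ : Set (Fin n → ℤ)),
      Real.exp (-(Real.pi * s ^ 2) * ‖W fun i ↦ (k.1 i : ℝ)‖ ^ 2) ≤ ε := by
  have hsum := summable_gaussian W Real.pi_pos 0
  simp only [zero_add] at hsum
  have hlim : Tendsto (fun s : ℝ ↦ ∑' k : ({0}ᶜ : Set (Fin n → ℤ)),
      Real.exp (-(Real.pi * s ^ 2) * ‖W fun i ↦ (k.1 i : ℝ)‖ ^ 2)) atTop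
      (𝓝 (∑' _ : ({0}ᶜ : Set (Fin n → ℤ)), (0 : ℝ))) := by
    refine tendsto_tsum_of_dominated_convergence (hsum.subtype ({0}ᶜ : Set (Fin n → ℤ))) (fun k ↦ ?_) ?_
    · have hk : 0 < ‖W fun i ↦ (k.1 i : ℝ)‖ := by
        refine norm_pos_iff.2 fun h ↦ k.2 ?_
        have := (map_eq_zero_iff W W.injective).1 h
        ext i
        simpa using congrFun this i
      refine Real.tendsto_exp_atBot.comp ?_
      have : Tendsto (fun s : ℝ ↦ -((Real.pi * ‖W fun i ↦ (k.1 i : ℝ)‖ ^ 2) * s ^ 2)) atTop atBot :=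
        tendsto_neg_atTop_atBot.comp
          ((tendsto_pow_atTop two_ne_zero).const_mul_atTop (by positivity))
      refine this.congr fun s ↦ by ring
    · filter_upwards [eventually_ge_atTop 1] with s hs k
      rw [Real.norm_of_nonneg (Real.exp_pos _).le]
      refine Real.exp_le_exp.2 (mul_le_mul_of_nonneg_right ?_ (by positivity))
      exact neg_le_neg (le_mul_of_one_le_right Real.pi_pos.le (one_le_pow₀ hs))
  rw [tsum_zero] at hlim
  obtain ⟨s, hs, hs0⟩ := ((hlim.eventually_le_const hε).and (eventually_gt_atTop 0)).exists
  exact ⟨s, hs0, hs⟩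

/-- If every point is within `r / 2` of the lattice, then the lattice vectors of norm at
most `r` span the space. -/
lemma span_short_eq_top {b : Fin n → Euc n} {T : (Fin n → ℝ) ≃L[ℝ] Euc n}
    (hT : ∀ x, T x = ∑ i, x i • b i) {r : ℝ}
    (hcover : ∀ x, ∃ k : Fin n → ℤ, ‖T (x + fun i ↦ (k i : ℝ))‖ ≤ r / 2) :
    Submodule.span ℝ {y ∈ (Submodule.span ℤ (Set.range b) : Set (Euc n)) | ‖y‖ ≤ r} = ⊤ := by
  set S := Submodule.span ℝ {y ∈ (Submodule.span ℤ (Set.range b) : Set (Euc n)) | ‖y‖ ≤ r} with hS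
  let e : (Fin n → ℤ) → Euc n := fun k ↦ T fun i ↦ (k i : ℝ)
  have hshort : ∀ k, ‖e k‖ ≤ r → e k ∈ S := fun k hk ↦
    Submodule.subset_span ⟨mem_span_int_range_iff.2 ⟨k, hT _⟩, hk⟩
  suffices hall : ∀ k, e k ∈ S by
    classical
    rw [eq_top_iff]
    intro y _
    rw [← T.apply_symm_apply y, hT]
    refine Submodule.sum_mem _ fun i _ ↦ Submodule.smul_mem _ _ ?_
    have : e (Pi.single i 1) = b i := by
      simp only [e, hT]
      rw [Finset.sum_eq_single i] <;> simp +contextual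
    exact this ▸ hall _
  by_contra! ⟨k₀, hk₀⟩
  have hfin : {k | e k ∉ S ∧ ‖e k‖ ≤ ‖e k₀‖}.Finite := by
    have hsum := summable_gaussian T one_pos 0
    simp only [zero_add] at hsum
    have hev := hsum.tendsto_cofinite_zero.eventually_lt_const (Real.exp_pos (-1 * ‖e k₀‖ ^ 2))
    refine (Filter.eventually_cofinite.1 hev).subset fun k hk ↦ ?_
    rw [Set.mem_ofPred_eq, not_lt]
    refine Real.exp_le_exp.2 ?_
    have := pow_le_pow_left₀ (norm_nonneg _) hk.2 2
    simp only [e] at this ⊢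
    linarith
  obtain ⟨k, ⟨hkS, hk⟩, hmin⟩ := Set.exists_min_image _ (fun k ↦ ‖e k‖) hfin ⟨k₀, hk₀, le_rfl⟩
  have hmin' : ∀ l, ‖e l‖ < ‖e k‖ → e l ∈ S := by
    intro l hl
    by_contra hlS
    exact (hmin l ⟨hlS, hl.le.trans hk⟩).not_gt hl
  have hlong : r < ‖e k‖ := lt_of_not_ge fun h ↦ hkS (hshort k h)
  obtain ⟨m, hm⟩ := hcover fun i ↦ (k i : ℝ) / 2
  have hm' : T ((fun i ↦ (k i : ℝ) / 2) + fun i ↦ (m i : ℝ)) = (1 / 2 : ℝ) • e k + e m := by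
    simp only [e]
    rw [← map_smul, ← map_add]
    congr 1
    ext i
    simp
    ring
  rw [hm'] at hm
  have hhalf : ‖(1 / 2 : ℝ) • e k‖ = ‖e k‖ / 2 := by
    rw [norm_smul, Real.norm_of_nonneg (by norm_num)]
    ring
  have h₁ : e m ∈ S := by
    refine hmin' m ?_
    have := norm_sub_le ((1 / 2 : ℝ) • e k + e m) ((1 / 2 : ℝ) • e k)
    rw [add_sub_cancel_left] at this
    linarith
  have hadd : e (k + m) = e k + e m := by
    simp only [e]
    rw [← map_add]
    congr 1
    ext i
    simp
  have h₂ : e (k + m) ∈ S := by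
    refine hmin' (k + m) ?_
    have := norm_add_le ((1 / 2 : ℝ) • e k + e m) ((1 / 2 : ℝ) • e k)
    have heq : (1 / 2 : ℝ) • e k + e m + (1 / 2 : ℝ) • e k = e (k + m) := by
      rw [hadd]
      module
    rw [heq] at this
    linarith
  rw [hadd] at h₂
  exact hkS ((Submodule.add_mem_iff_left S h₁).1 h₂)

end SmoothingParameter

theorem eta_ge_lambda_n_div_sqrt {n : ℕ} (hn : 20 ≤ n) (b : Fin n → Euc n)
    (hb : LinearIndependent ℝ b)
    (L : Set (Euc n)) (hL : L = (Submodule.span ℤ (Set.range b) : Submodule ℤ (Euc n))) :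
    succMin L n / Real.sqrt n ≤ eta (1/2) L := by
  subst hL
  obtain ⟨T, W, hT, hW, hWb⟩ := exists_coordinate_maps hb
  have hn0 : 0 < √(n : ℝ) := Real.sqrt_pos.2 (by exact_mod_cast (by lia : 0 < n))
  obtain ⟨s₀, hs₀, hmass₀⟩ := exists_dual_mass_le W (ε := 1 / 2) (by norm_num)
  refine le_csInf ⟨s₀, hs₀, by rwa [gaussianMass_dualLattice_eq hb hWb]⟩ ?_
  rintro s ⟨hs, hmass⟩
  rw [gaussianMass_dualLattice_eq hb hWb] at hmass
  rw [div_le_iff₀ hn0]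
  refine csInf_le ⟨0, fun r hr ↦ hr.1⟩ ⟨by positivity, ?_⟩
  rw [span_short_eq_top hT (exists_norm_le_of_dual_mass_le hn T W hW hs hmass)]
  simp
end
end

section
/- For any lattice $\mathcal{L} \subset \mathbb{R}^n$ and any $s > 0$, $\mathbb{E}_{\vec{X} \sim D_{\mathcal{L},s}}[\|\vec{X}\|^2] \le n s^2/(2\pi)$. -/
open scoped BigOperators RealInnerProductSpace

noncomputable section

section PositiveDefinite

variable {G : Type*} [AddCommGroup G]

/-- A sum over pairs congruent modulo `2 G`, seen as a sum of squares of coset sums. -/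
theorem tsum_mul_tsum_sub_two_nsmul_nonneg (hG : ∀ x : G, 2 • x = 0 → x = 0) {d : G → ℝ}
    (hd : Summable fun x ↦ d x * ∑' w, d (x - 2 • w)) :
    0 ≤ ∑' x, d x * ∑' w, d (x - 2 • w) := by
  let q : G → G ⧸ (nsmulAddMonoidHom (α := G) 2).range := QuotientAddGroup.mk
  rw [← (hd.hasSum.tsum_fiberwise q).tsum_eq]
  refine tsum_nonneg fun c ↦ ?_
  obtain ⟨x₀, rfl⟩ := QuotientAddGroup.mk_surjective c
  have hmem (w : G) : q (x₀ - 2 • w) = q x₀ := by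
    refine QuotientAddGroup.eq.2 ⟨w, ?_⟩
    simp
  let e : G ≃ q ⁻¹' {q x₀} := Equiv.ofBijective (fun w ↦ ⟨x₀ - 2 • w, hmem w⟩) <| by
    refine ⟨fun v w h ↦ ?_, fun ⟨x, hx⟩ ↦ ?_⟩
    · have h' : 2 • v = 2 • w := by simpa using congrArg Subtype.val h
      exact sub_eq_zero.1 (hG _ (by rw [smul_sub, h', sub_self]))
    · obtain ⟨w, hw⟩ := QuotientAddGroup.eq.1 hx
      refine ⟨w, Subtype.ext ?_⟩
      have hw' : 2 • w = -x + x₀ := hw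
      simp [hw']
  have hinv (v : G) : ∑' w, d (x₀ - 2 • v - 2 • w) = ∑' w, d (x₀ - 2 • w) := by
    rw [← (Equiv.addLeft v).tsum_eq fun w ↦ d (x₀ - 2 • w)]
    simp [smul_add, sub_sub]
  change 0 ≤ ∑' x : q ⁻¹' {q x₀}, d x * ∑' w, d (x - 2 • w)
  rw [← e.tsum_eq fun x ↦ d x * ∑' w, d (x - 2 • w)]
  change 0 ≤ ∑' v, d (x₀ - 2 • v) * ∑' w, d (x₀ - 2 • v - 2 • w)
  simp_rw [hinv, tsum_mul_right]
  exact mul_self_nonneg _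

theorem tsum_mul_add_sub_nonneg (hG : ∀ x : G, 2 • x = 0 → x = 0) {d : G → ℝ}
    (hd : Summable fun p : G × G ↦ d (p.1 + p.2) * d (p.1 - p.2)) :
    0 ≤ ∑' p : G × G, d (p.1 + p.2) * d (p.1 - p.2) := by
  let e : G × G ≃ G × G :=
    { toFun := fun p ↦ (p.1 - p.2, p.2)
      invFun := fun p ↦ (p.1 + p.2, p.2)
      left_inv := fun p ↦ by simp
      right_inv := fun p ↦ by simp }
  have heq : (fun p : G × G ↦ d (p.1 + p.2) * d (p.1 - p.2)) ∘ e =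
      fun p ↦ d p.1 * d (p.1 - 2 • p.2) := by
    funext p
    simp [e, two_nsmul, sub_sub]
  have hsum : Summable fun p : G × G ↦ d p.1 * d (p.1 - 2 • p.2) := heq ▸ e.summable_iff.2 hd
  rw [← e.tsum_eq fun p : G × G ↦ d (p.1 + p.2) * d (p.1 - p.2)]
  change 0 ≤ ∑' p, ((fun p : G × G ↦ d (p.1 + p.2) * d (p.1 - p.2)) ∘ e) p
  rw [heq, hsum.tsum_prod]
  have hprod := hsum.prod
  simp_rw [tsum_mul_left] at hprod ⊢
  exact tsum_mul_tsum_sub_two_nsmul_nonneg hG hprod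

end PositiveDefinite

theorem two_add_sq_le_exp_add_exp_neg (x : ℝ) : 2 + x ^ 2 ≤ Real.exp x + Real.exp (-x) := by
  have h := Real.cosh_two_mul (x / 2)
  rw [mul_div_cancel₀ x two_ne_zero, Real.cosh_sq, Real.cosh_eq] at h
  have hs : (x / 2) ^ 2 ≤ Real.sinh (x / 2) ^ 2 := by
    rcases le_total 0 (x / 2) with hx | hx
    · have := Real.self_le_sinh_iff.2 hx
      gcongr
    · have := Real.sinh_le_self_iff.2 hx
      nlinarith
  linarith

section GaussianSum

variable {E : Type*} [NormedAddCommGroup E]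

/-- The Gaussian mass, with exponent `c`, of the translate `L - z`. -/
def gaussianSum (L : Submodule ℤ E) (c : ℝ) (z : E) : ℝ :=
  ∑' x : L, Real.exp (-c * ‖(x : E) - z‖ ^ 2)

theorem exp_neg_mul_norm_sub_sq_le {c : ℝ} (hc : 0 ≤ c) (x z : E) :
    Real.exp (-c * ‖x - z‖ ^ 2) ≤ Real.exp (c * ‖z‖ ^ 2) * Real.exp (-(c / 2) * ‖x‖ ^ 2) := by
  rw [← Real.exp_add, Real.exp_le_exp]
  have h : ‖x‖ ^ 2 ≤ 2 * ‖x - z‖ ^ 2 + 2 * ‖z‖ ^ 2 := by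
    have := norm_add_le (x - z) z
    rw [sub_add_cancel] at this
    nlinarith [sq_nonneg (‖x - z‖ - ‖z‖), norm_nonneg x]
  nlinarith

theorem gaussianSum_neg (L : Submodule ℤ E) (c : ℝ) (z : E) :
    gaussianSum L c (-z) = gaussianSum L c z := by
  unfold gaussianSum
  rw [← (Equiv.neg L).tsum_eq]
  refine tsum_congr fun x ↦ ?_
  rw [← norm_neg]
  congr 4
  simp [add_comm, sub_eq_add_neg]

theorem gaussianSum_sub_coe (L : Submodule ℤ E) (c : ℝ) (z : E) (v : L) :
    gaussianSum L c (z - v) = gaussianSum L c z := by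
  unfold gaussianSum
  rw [← (Equiv.subRight v).tsum_eq]
  simp

variable [InnerProductSpace ℝ E]

theorem exp_mul_sq_inner_le (c : ℝ) (y e : E) (τ : ℝ) :
    Real.exp (-c * ‖y‖ ^ 2) * (2 + (2 * c * τ) ^ 2 * inner ℝ y e ^ 2) ≤
      Real.exp (c * τ ^ 2 * ‖e‖ ^ 2) *
        (Real.exp (-c * ‖y - τ • e‖ ^ 2) + Real.exp (-c * ‖y - (-τ) • e‖ ^ 2)) := by
  have h (σ : ℝ) : ‖y - σ • e‖ ^ 2 = ‖y‖ ^ 2 - 2 * σ * inner ℝ y e + σ ^ 2 * ‖e‖ ^ 2 := by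
    rw [norm_sub_sq_real, inner_smul_right, norm_smul, mul_pow, Real.norm_eq_abs, sq_abs]
    ring
  have hrhs : Real.exp (c * τ ^ 2 * ‖e‖ ^ 2) *
        (Real.exp (-c * ‖y - τ • e‖ ^ 2) + Real.exp (-c * ‖y - (-τ) • e‖ ^ 2)) =
      Real.exp (-c * ‖y‖ ^ 2) *
        (Real.exp (2 * c * τ * inner ℝ y e) + Real.exp (-(2 * c * τ * inner ℝ y e))) := by
    simp only [h, mul_add (Real.exp _), ← Real.exp_add]
    ring_nf
  rw [hrhs, ← mul_pow]
  exact mul_le_mul_of_nonneg_left (two_add_sq_le_exp_add_exp_neg _) (Real.exp_pos _).le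

variable [FiniteDimensional ℝ E] (L : Submodule ℤ E) [DiscreteTopology L] {c : ℝ}

theorem summable_exp_neg_mul_norm_sq (hc : 0 < c) :
    Summable fun x : L ↦ Real.exp (-c * ‖(x : E)‖ ^ 2) := by
  let k := Module.finrank ℤ L + 1
  have hs : Summable fun x : L ↦ ‖x‖⁻¹ ^ (2 * k) :=
    ZLattice.summable_norm_pow_inv L (2 * k) (by lia)
  refine Summable.of_norm_bounded_eventually (hs.mul_left (k.factorial / c ^ k)) ?_
  rw [Filter.eventually_cofinite]
  refine (Set.finite_singleton (0 : L)).subset fun x hx ↦ ?_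
  by_contra hx0
  refine hx ?_
  have hpos : 0 < ‖(x : E)‖ := norm_pos_iff.2 fun h ↦ hx0 (by simpa using h)
  have hexp := Real.pow_div_factorial_le_exp (c * ‖(x : E)‖ ^ 2) (by positivity) k
  rw [Real.norm_of_nonneg (Real.exp_pos _).le, neg_mul, Real.exp_neg]
  calc (Real.exp (c * ‖(x : E)‖ ^ 2))⁻¹ ≤ ((c * ‖(x : E)‖ ^ 2) ^ k / k.factorial)⁻¹ := by
        gcongr
    _ = k.factorial / c ^ k * ‖x‖⁻¹ ^ (2 * k) := by
        rw [Submodule.coe_norm, mul_pow, ← pow_mul, inv_pow]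
        field_simp

theorem summable_exp_neg_mul_norm_sub_sq (hc : 0 < c) (z : E) :
    Summable fun x : L ↦ Real.exp (-c * ‖(x : E) - z‖ ^ 2) :=
  .of_nonneg_of_le (fun _ ↦ (Real.exp_pos _).le)
    (fun x ↦ exp_neg_mul_norm_sub_sq_le hc.le (x : E) z)
    ((summable_exp_neg_mul_norm_sq L (half_pos hc)).mul_left _)

theorem gaussianSum_pos (hc : 0 < c) (z : E) : 0 < gaussianSum L c z :=
  (summable_exp_neg_mul_norm_sub_sq L hc z).tsum_pos (fun _ ↦ (Real.exp_pos _).le) 0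
    (Real.exp_pos _)

theorem hasSum_gaussianSum_mul (hc : 0 < c) (y z : E) :
    HasSum (fun p : L × L ↦
      Real.exp (-c * ‖(p.1 : E) - y‖ ^ 2) * Real.exp (-c * ‖(p.2 : E) - z‖ ^ 2))
      (gaussianSum L c y * gaussianSum L c z) := by
  have hy := (summable_exp_neg_mul_norm_sub_sq L hc y).norm
  have hz := (summable_exp_neg_mul_norm_sub_sq L hc z).norm
  unfold gaussianSum
  rw [tsum_mul_tsum_of_summable_norm hy hz]
  exact (summable_mul_of_summable_norm hy hz).hasSum

/-- By the parallelogram law, all the products of Gaussians appearing here factor. -/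
theorem two_mul_gaussianSum_sq_le (hc : 0 < c) (z : E) :
    2 * gaussianSum L c z ^ 2 ≤
      gaussianSum L c 0 ^ 2 + gaussianSum L c 0 * gaussianSum L c ((2 : ℝ) • z) := by
  let d : L → ℝ := fun x ↦ Real.exp (-(c / 2) * ‖(x : E)‖ ^ 2) -
    Real.exp (-(c / 2) * ‖(x : E) - (2 : ℝ) • z‖ ^ 2)
  have factor (a b y w : E) (h₁ : a + b = (2 : ℝ) • y) (h₂ : a - b = (2 : ℝ) • w) :
      Real.exp (-(c / 2) * ‖a‖ ^ 2) * Real.exp (-(c / 2) * ‖b‖ ^ 2) =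
        Real.exp (-c * ‖y‖ ^ 2) * Real.exp (-c * ‖w‖ ^ 2) := by
    rw [← Real.exp_add, ← Real.exp_add]
    have h := parallelogram_law_with_norm ℝ a b
    rw [h₁, h₂, norm_smul, norm_smul] at h
    norm_num at h
    congr 1
    linear_combination (c / 4) * h
  have hsum : HasSum (fun p : L × L ↦ d (p.1 + p.2) * d (p.1 - p.2))
      (gaussianSum L c 0 * gaussianSum L c 0 - gaussianSum L c z * gaussianSum L c (-z)
        - gaussianSum L c z * gaussianSum L c z
        + gaussianSum L c ((2 : ℝ) • z) * gaussianSum L c 0) := by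
    refine ((((hasSum_gaussianSum_mul L hc 0 0).sub (hasSum_gaussianSum_mul L hc z (-z))).sub
      (hasSum_gaussianSum_mul L hc z z)).add
      (hasSum_gaussianSum_mul L hc ((2 : ℝ) • z) 0)).congr_fun ?_
    intro p
    obtain ⟨v, w⟩ := p
    simp only [d, Submodule.coe_add, Submodule.coe_sub]
    rw [sub_mul, mul_sub, mul_sub,
      factor ((v : E) + w) (v - w) (v - 0) (w - 0) (by module) (by module),
      factor ((v : E) + w) (v - w - (2 : ℝ) • z) (v - z) (w - -z) (by module) (by module),
      factor ((v : E) + w - (2 : ℝ) • z) (v - w) (v - z) (w - z) (by module) (by module),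
      factor ((v : E) + w - (2 : ℝ) • z) (v - w - (2 : ℝ) • z) (v - (2 : ℝ) • z) (w - 0)
        (by module) (by module)]
    ring
  have htor (x : L) (hx : 2 • x = 0) : x = 0 := by
    have h : (2 : ℝ) • (x : E) = 0 := by
      have := congrArg (Subtype.val) hx
      simpa [two_smul, two_nsmul] using this
    exact Subtype.ext ((smul_eq_zero.1 h).resolve_left two_ne_zero)
  have hnonneg := tsum_mul_add_sub_nonneg htor hsum.summable
  rw [hsum.tsum_eq, gaussianSum_neg] at hnonneg
  linarith

theorem gaussianSum_le_mul_exp (hc : 0 < c) (z : E) :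
    gaussianSum L c z ≤ Real.exp (c * ‖z‖ ^ 2) * gaussianSum L (c / 2) 0 := by
  unfold gaussianSum
  rw [← tsum_mul_left]
  refine (summable_exp_neg_mul_norm_sub_sq L hc z).tsum_le_tsum (fun x ↦ ?_)
    ((summable_exp_neg_mul_norm_sub_sq L (half_pos hc) 0).mul_left _)
  simpa using exp_neg_mul_norm_sub_sq_le hc.le (x : E) z

variable {ι : Type*} [Fintype ι] (b : Module.Basis ι ℝ E)

theorem bddAbove_range_gaussianSum (hc : 0 < c) :
    BddAbove (Set.range (gaussianSum (Submodule.span ℤ (Set.range b)) c)) := by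
  let L := Submodule.span ℤ (Set.range b)
  refine ⟨Real.exp (c * (∑ i, ‖b i‖) ^ 2) * gaussianSum L (c / 2) 0, ?_⟩
  rintro _ ⟨z, rfl⟩
  rw [← gaussianSum_sub_coe L c z (ZSpan.floor b z), ← ZSpan.fract_apply]
  refine (gaussianSum_le_mul_exp L hc _).trans ?_
  have := gaussianSum_pos L (half_pos hc) 0
  gcongr
  exact ZSpan.norm_fract_le b z

theorem gaussianSum_le_gaussianSum_zero (hc : 0 < c) (z : E) :
    gaussianSum (Submodule.span ℤ (Set.range b)) c z ≤
      gaussianSum (Submodule.span ℤ (Set.range b)) c 0 := by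
  let L := Submodule.span ℤ (Set.range b)
  let M := ⨆ y, gaussianSum L c y
  have hle (y : E) : gaussianSum L c y ≤ M := le_ciSup (bddAbove_range_gaussianSum b hc) y
  have h₀ := gaussianSum_pos L hc 0
  have hM : M ≤ √((gaussianSum L c 0 ^ 2 + gaussianSum L c 0 * M) / 2) := by
    refine ciSup_le fun y ↦ Real.le_sqrt_of_sq_le ?_
    have := two_mul_gaussianSum_sq_le L hc y
    have := mul_le_mul_of_nonneg_left (hle ((2 : ℝ) • y)) h₀.le
    linarith
  have hM₀ : 0 < M := h₀.trans_le (hle 0)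
  have hsq := (Real.le_sqrt hM₀.le (by positivity)).1 hM
  refine (hle z).trans ?_
  change M ≤ gaussianSum L c 0
  nlinarith

theorem summable_inner_sq_mul_exp (hc : 0 < c) (e : E) :
    Summable fun y : L ↦ inner ℝ (y : E) e ^ 2 * Real.exp (-c * ‖(y : E)‖ ^ 2) := by
  refine .of_nonneg_of_le (fun _ ↦ by positivity) (fun y ↦ ?_)
    ((((summable_exp_neg_mul_norm_sub_sq L hc ((1 : ℝ) • e)).add
      (summable_exp_neg_mul_norm_sub_sq L hc ((-1 : ℝ) • e))).mul_left
        (Real.exp (c * 1 ^ 2 * ‖e‖ ^ 2))).mul_left ((2 * c * 1) ^ 2)⁻¹)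
  refine le_trans ?_ (mul_le_mul_of_nonneg_left (exp_mul_sq_inner_le c (y : E) e 1)
    (by positivity))
  rw [le_inv_mul_iff₀ (by positivity)]
  nlinarith [Real.exp_pos (-c * ‖(y : E)‖ ^ 2)]

/-- The second-order optimality condition at the origin in the direction `e`. -/
theorem two_mul_tsum_inner_sq_le (hc : 0 < c) {e : E} (he : ‖e‖ = 1) :
    2 * c * ∑' y : Submodule.span ℤ (Set.range b),
        inner ℝ (y : E) e ^ 2 * Real.exp (-c * ‖(y : E)‖ ^ 2) ≤
      gaussianSum (Submodule.span ℤ (Set.range b)) c 0 := by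
  let L := Submodule.span ℤ (Set.range b)
  let m := ∑' y : L, inner ℝ (y : E) e ^ 2 * Real.exp (-c * ‖(y : E)‖ ^ 2)
  let f₀ := gaussianSum L c 0
  have hf₀ : 0 < f₀ := gaussianSum_pos L hc 0
  have key (τ : ℝ) : 2 * f₀ + (2 * c * τ) ^ 2 * m ≤ Real.exp (c * τ ^ 2) * (2 * f₀) := by
    have hl : HasSum (fun y : L ↦ Real.exp (-c * ‖(y : E)‖ ^ 2) *
        (2 + (2 * c * τ) ^ 2 * inner ℝ (y : E) e ^ 2)) (2 * f₀ + (2 * c * τ) ^ 2 * m) := by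
      have h₁ := (summable_exp_neg_mul_norm_sub_sq L hc 0).hasSum.mul_left 2
      refine (h₁.add
        ((summable_inner_sq_mul_exp L hc e).hasSum.mul_left ((2 * c * τ) ^ 2))).congr_fun ?_
      intro y
      rw [sub_zero]
      ring
    have hr := (((summable_exp_neg_mul_norm_sub_sq L hc (τ • e)).hasSum.add
      (summable_exp_neg_mul_norm_sub_sq L hc ((-τ) • e)).hasSum).mul_left
        (Real.exp (c * τ ^ 2 * ‖e‖ ^ 2)))
    refine (hasSum_le (fun y : L ↦ exp_mul_sq_inner_le c (y : E) e τ) hl hr).trans ?_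
    have h₁ := gaussianSum_le_gaussianSum_zero b hc (τ • e)
    have h₂ := gaussianSum_le_gaussianSum_zero b hc ((-τ) • e)
    rw [he, one_pow, mul_one, two_mul f₀]
    gcongr
    · exact h₁
    · exact h₂
  have hu (u : ℝ) (hu₀ : 0 < u) (hu₁ : u < 1) : 2 * c * m * (1 - u) ≤ f₀ := by
    have hτ : c * √(u / c) ^ 2 = u := by
      rw [Real.sq_sqrt (by positivity), mul_div_cancel₀ _ hc.ne']
    have h := key √(u / c)
    have h' : (2 * c * √(u / c)) ^ 2 = 4 * c * u := by linear_combination 4 * c * hτ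
    rw [hτ, h'] at h
    have hexp := Real.exp_bound_div_one_sub_of_interval hu₀.le hu₁
    rw [le_div_iff₀ (by linarith)] at hexp
    have h1u : 0 < 1 - u := by linarith
    have h2 := mul_le_mul_of_nonneg_left h h1u.le
    have h3 : (1 - u) * (Real.exp u * (2 * f₀)) ≤ 2 * f₀ := by nlinarith
    refine le_of_mul_le_mul_left ?_ hu₀
    linarith
  change 2 * c * m ≤ f₀
  by_contra! hlt
  have hA : 0 < 2 * c * m := hf₀.trans hlt
  have h := hu ((2 * c * m - f₀) / (2 * (2 * c * m))) (div_pos (by linarith) (by linarith))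
    ((div_lt_one (by linarith)).2 (by linarith))
  have h' : 2 * c * m * (1 - (2 * c * m - f₀) / (2 * (2 * c * m))) = (2 * c * m + f₀) / 2 := by
    generalize 2 * c * m = A at hA
    field_simp
    ring
  linarith

end GaussianSum

theorem discrete_gaussian_second_moment {n : ℕ} (b : Fin n → Euc n)
    (hb : LinearIndependent ℝ b)
    (L : Set (Euc n)) (hL : L = (Submodule.span ℤ (Set.range b) : Submodule ℤ (Euc n)))
    (s : ℝ) (hs : 0 < s) :
    (∑' y : L, ‖(y : Euc n)‖ ^ 2 * Real.exp (-Real.pi * ‖(y : Euc n)‖ ^ 2 / s ^ 2)) /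
        gaussianMass s L ≤ n * s ^ 2 / (2 * Real.pi) := by
  subst hL
  obtain ⟨B, rfl⟩ : ∃ B : Module.Basis (Fin n) ℝ (Euc n), ⇑B = b :=
    ⟨.mk hb (hb.span_eq_top_of_card_eq_finrank' (by simp)).ge, Module.Basis.coe_mk hb _⟩
  let c := Real.pi / s ^ 2
  have hc : 0 < c := by positivity
  have hexp (y : Euc n) : -Real.pi * ‖y‖ ^ 2 / s ^ 2 = -c * ‖y‖ ^ 2 := by
    simp only [c]
    ring
  let Λ := Submodule.span ℤ (Set.range B)
  have hmass : gaussianMass s (Λ : Set (Euc n)) = gaussianSum Λ c 0 := by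
    simp only [gaussianMass, gaussianSum, hexp, sub_zero]
    rfl
  have hpos := gaussianSum_pos Λ hc 0
  rw [hmass, div_le_iff₀ hpos]
  simp_rw [hexp]
  change ∑' y : Λ, ‖(y : Euc n)‖ ^ 2 * Real.exp (-c * ‖(y : Euc n)‖ ^ 2) ≤ _
  let e (i : Fin n) : Euc n := EuclideanSpace.single i 1
  have hinner (y : Euc n) : ‖y‖ ^ 2 = ∑ i, inner ℝ y (e i) ^ 2 := by
    simp [EuclideanSpace.real_norm_sq_eq, e, EuclideanSpace.inner_single_right]
  simp_rw [hinner, Finset.sum_mul, ← hinner]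
  rw [Summable.tsum_finsetSum fun i _ ↦ summable_inner_sq_mul_exp Λ hc (e i)]
  have hi (i : Fin n) : ∑' y : Λ, inner ℝ (y : Euc n) (e i) ^ 2 *
      Real.exp (-c * ‖(y : Euc n)‖ ^ 2) ≤ s ^ 2 / (2 * Real.pi) * gaussianSum Λ c 0 := by
    have h := two_mul_tsum_inner_sq_le B hc (e := e i) (by simp [e])
    rw [← le_div_iff₀' (by positivity)] at h
    refine h.trans_eq ?_
    simp only [c, Λ]
    field_simp
  refine (Finset.sum_le_sum fun i _ ↦ hi i).trans_eq ?_
  simp only [Finset.sum_const, Finset.card_univ, Fintype.card_fin, nsmul_eq_mul]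
  ring
end
end
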